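/- arXiv:2212.02290 — 3 statements merged into one kernel-verified Lean document; each statement's English description precedes it below -/
import Mathlib

section
/- (Element-level almost algebraic order, axiom (O5), for Cuntz comparison) Let A be a C*-algebra, let a, b ∈ A be positive with a ≾ b, and let ε > 0. Then there exists a positive element c ∈ A such that, in the C*-algebra M₂(A) = CStarMatrix (Fin 2) A, diag((a − 2ε)₊, c) ≾ diag(b, 0) and diag(b, 0) ≾ diag(a, c). -/
/-- Cuntz subequivalence in a (non-unital) C*-algebra. -/
def CuntzLE {A : Type*} [NonUnitalCStarAlgebra A] (a b : A) : Prop :=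
  ∀ ε > 0, ∃ r : A, ‖r * b * star r - a‖ < ε

/-- Cuntz equivalence. -/
def CuntzEquiv {A : Type*} [NonUnitalCStarAlgebra A] (a b : A) : Prop :=
  CuntzLE a b ∧ CuntzLE b a

/-- The ε-cut-down `(a - ε)₊` of an element, via non-unital continuous functional calculus. -/
noncomputable def cutDown {A : Type*} [NonUnitalCStarAlgebra A] (a : A) (ε : ℝ) : A :=
  cfcₙ (fun t : ℝ => max (t - ε) 0) a

section helpers
variable {A : Type*} [NonUnitalCStarAlgebra A] [PartialOrder A] [StarOrderedRing A]

lemma aux_conj (z : A) (hz : IsSelfAdjoint z) (m : ℝ → ℝ) (hm : Continuous m) (h0 : m 0 = 0) :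
    cfcₙ m z * z * cfcₙ m z = cfcₙ (fun t => m t * t * m t) z := by
  have h1 : cfcₙ (fun t => m t * t) z = cfcₙ m z * z := by
    rw [cfcₙ_mul m (fun t => t) z hm.continuousOn h0 continuousOn_id rfl, cfcₙ_id' ℝ z]
  rw [cfcₙ_mul (fun t => m t * t) m z (by fun_prop) (by simp) hm.continuousOn h0, h1]

lemma aux_le (x y : A) (hx : 0 ≤ x) (hy : 0 ≤ y) (C : ℝ) (hC : 0 < C) (hxy : x ≤ C • y) :
    CuntzLE x y := by
  intro η hη
  obtain ⟨w, hw0, hw⟩ : ∃ w : A, 0 ≤ w ∧ w * w = x :=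
    ⟨CFC.sqrt x, CFC.sqrt_nonneg x, CFC.sqrt_mul_sqrt_self x⟩
  have hws : star w = w := hw0.isSelfAdjoint
  obtain ⟨v, hv⟩ : ∃ v : A, v * star v = C • y - x := by
    have h := sub_nonneg.mpr hxy
    refine ⟨CFC.sqrt (C • y - x), ?_⟩
    rw [(CFC.sqrt_nonneg (C • y - x)).isSelfAdjoint.star_eq, CFC.sqrt_mul_sqrt_self _ h]
  have hys : IsSelfAdjoint y := hy.isSelfAdjoint
  set d : ℝ := (η / (‖w‖ + 1)) ^ 2 / (4 * C) with hd
  have hd0 : 0 < d := by positivity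
  have hden : ∀ t : ℝ, |t| + d ≠ 0 := fun t => by positivity
  set m : ℝ → ℝ := fun t => Real.sqrt |t| / (|t| + d) with hm
  have hmc : Continuous m := by
    refine Continuous.div (by fun_prop) (by fun_prop) hden
  have hm0 : m 0 = 0 := by simp [hm]
  set nf : ℝ → ℝ := fun t => m t * t * m t with hnf
  have hnc : Continuous nf := by fun_prop
  have hn0 : nf 0 = 0 := by simp [hnf]
  set n := cfcₙ nf y with hn
  have hns : star n = n := IsSelfAdjoint.cfcₙ
  have hconj := aux_conj y hys m hmc hm0
  set M := cfcₙ m y with hM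
  have hMs : star M = M := IsSelfAdjoint.cfcₙ
  have hyn : y - n * y = cfcₙ (fun t => t - nf t * t) y := by
    rw [cfcₙ_sub (fun t => t) (fun t => nf t * t) y (by fun_prop) rfl (by fun_prop) (by simp),
      cfcₙ_mul nf (fun t => t) y (by fun_prop) hn0 (by fun_prop) rfl, cfcₙ_id' ℝ y]
  have hyn2 : (y - n * y) - (y - n * y) * n
      = cfcₙ (fun t => (t - nf t * t) - (t - nf t * t) * nf t) y := by
    rw [cfcₙ_sub (fun t => t - nf t * t) (fun t => (t - nf t * t) * nf t) y (by fun_prop)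
      (by simp) (by fun_prop) (by simp),
      cfcₙ_mul (fun t => t - nf t * t) nf y (by fun_prop) (by simp) (by fun_prop) hn0, ← hyn]
  have hnorm : ‖(y - n * y) - (y - n * y) * n‖ ≤ 2 * d := by
    rw [hyn2]
    apply norm_cfcₙ_le
    intro t ht
    have ht0 : 0 ≤ t := quasispectrum_nonneg_of_nonneg y hy t ht
    have e1 : nf t = (t / (t + d)) ^ 2 := by
      simp only [hnf, hm, abs_of_nonneg ht0]
      have := Real.mul_self_sqrt ht0
      have h2 : t + d ≠ 0 := by positivity
      field_simp
      rw [Real.sq_sqrt ht0]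
      ring
    set u := t / (t + d) with hu
    have hu0 : 0 ≤ u := by positivity
    have hu1 : u ≤ 1 := by rw [hu, div_le_one (by positivity)]; linarith
    have hut : t * (1 - u) ≤ d := by
      have : t * (1 - u) = u * d := by
        rw [hu]; field_simp; ring
      rw [this]; nlinarith
    have : (t - nf t * t) - (t - nf t * t) * nf t = (t * (1 - u)) * ((1 + u) * (1 - u ^ 2)) := by
      rw [e1]; ring
    rw [this, Real.norm_eq_abs, abs_of_nonneg]
    · have h1 : (1 + u) * (1 - u ^ 2) ≤ 2 := by nlinarith [mul_nonneg hu0 hu0, mul_nonneg (mul_nonneg hu0 hu0) hu0]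
      have h3 : 0 ≤ t * (1 - u) := mul_nonneg ht0 (by linarith)
      nlinarith
    · exact mul_nonneg (mul_nonneg ht0 (by linarith)) (mul_nonneg (by linarith) (by nlinarith))
  have hle : (w - n * w) * star (w - n * w) ≤ C • ((y - n * y) - (y - n * y) * n) := by
    have h1 : 0 ≤ (v - n * v) * star (v - n * v) := mul_star_self_nonneg _
    rw [← sub_nonneg]
    convert h1 using 1
    have e1 : (v - n * v) * star (v - n * v)
      = v * star v - n * (v * star v) - (v * star v - n * (v * star v)) * n := by
      rw [star_sub, star_mul, hns]; noncomm_ring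
    have e2 : (w - n * w) * star (w - n * w)
      = w * w - n * (w * w) - (w * w - n * (w * w)) * n := by
      rw [star_sub, star_mul, hns, hws]; noncomm_ring
    rw [e1, e2, hv, hw]
    simp only [smul_sub, mul_sub, sub_mul, mul_smul_comm, smul_mul_assoc]
    abel
  have hN : ‖w - n * w‖ * ‖w - n * w‖ ≤ C * (2 * d) := by
    rw [← CStarRing.norm_self_mul_star]
    refine (CStarAlgebra.norm_le_norm_of_nonneg_of_le (mul_star_self_nonneg _) hle).trans ?_
    rw [norm_smul, Real.norm_eq_abs, abs_of_pos hC]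
    gcongr
  have hN2 : ‖w - n * w‖ < η / (‖w‖ + 1) := by
    have h1 : C * (2 * d) < (η / (‖w‖ + 1)) ^ 2 := by
      have : C * (2 * d) = (η / (‖w‖ + 1)) ^ 2 / 2 := by rw [hd]; field_simp; ring
      rw [this]; have : 0 < (η / (‖w‖ + 1)) ^ 2 := by positivity
      linarith
    refine lt_of_pow_lt_pow_left₀ 2 (by positivity) ?_
    nlinarith
  refine ⟨w * M, ?_⟩
  have : w * M * y * star (w * M) - x = - (w * (w - n * w)) := by
    rw [star_mul, hMs, hws, ← hw, hn, ← hconj]; noncomm_ring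
  rw [this, norm_neg]
  calc _ ≤ ‖w‖ * ‖w - n * w‖ := norm_mul_le _ _
    _ ≤ (‖w‖ + 1) * ‖w - n * w‖ := by gcongr; linarith
    _ < (‖w‖ + 1) * (η / (‖w‖ + 1)) := by gcongr
    _ = η := by field_simp

lemma aux_cut (a Z : A) (ha : IsSelfAdjoint a) (hZ : IsSelfAdjoint Z) (μ ν : ℝ) (hμ : 0 ≤ μ)
    (hμν : μ < ν) (h : ‖a - Z‖ ≤ μ) :
    ∃ f : A, IsSelfAdjoint f ∧ cutDown a ν ≤ f * Z * f := by
  set g : ℝ → ℝ := fun t => Real.sqrt (max (t - ν) 0 / max (t - μ) (ν - μ)) with hg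
  have hden : ∀ t : ℝ, 0 < max (t - μ) (ν - μ) := fun t => lt_max_of_lt_right (by linarith)
  have hgc : Continuous g :=
    Real.continuous_sqrt.comp (Continuous.div (by fun_prop) (by fun_prop) fun t => (hden t).ne')
  have hg0 : g 0 = 0 := by
    have : max (0 - ν) 0 = 0 := max_eq_right (by linarith)
    simp only [hg, this]; simp
  have hfs : star (cfcₙ g a) = cfcₙ g a := IsSelfAdjoint.cfcₙ
  refine ⟨cfcₙ g a, hfs, ?_⟩
  have h1 := CStarAlgebra.star_right_conjugate_le_norm_smul (a := cfcₙ g a) (b := a - Z) (ha.sub hZ)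
  have hff : 0 ≤ cfcₙ g a * star (cfcₙ g a) := mul_star_self_nonneg _
  have h2 := h1.trans (smul_le_smul_of_nonneg_right h hff)
  rw [hfs] at h2
  have h3 : cutDown a ν = cfcₙ g a * a * cfcₙ g a - μ • (cfcₙ g a * cfcₙ g a) := by
    rw [aux_conj a ha g hgc hg0, ← cfcₙ_mul g g a hgc.continuousOn hg0 hgc.continuousOn hg0,
      ← cfcₙ_smul μ _ a (by fun_prop) (by simp [hg0]),
      ← cfcₙ_sub _ _ a (by fun_prop) (by simp) (by fun_prop) (by simp [hg0]), cutDown]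
    congr 1
    ext t
    have e : g t * g t = max (t - ν) 0 / max (t - μ) (ν - μ) :=
      Real.mul_self_sqrt (div_nonneg (le_max_right _ _) (hden t).le)
    have : g t * t * g t - μ • (g t * g t) = (g t * g t) * (t - μ) := by
      rw [smul_eq_mul]; ring
    rw [this, e]
    rcases le_total t ν with ht | ht
    · rw [max_eq_right (by linarith)]; simp
    · rw [max_eq_left (a := t - μ) (by linarith)]
      have : t - μ ≠ 0 := by intro h; linarith
      field_simp
  rw [h3, ← sub_nonneg]
  rw [← sub_nonneg] at h2
  convert h2 using 1
  noncomm_ring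

lemma aux_core (a b : A) (ha : 0 ≤ a) (hb : 0 ≤ b) (hab : CuntzLE a b) (ε : ℝ) (hε : 0 < ε) :
    ∃ c : A, 0 ≤ c ∧
      (∀ η > 0, ∃ p q : A, ‖p * b * star p - cutDown a (2 * ε)‖ < η ∧ ‖p * b * star q‖ < η ∧
        ‖q * b * star p‖ < η ∧ ‖q * b * star q - c‖ < η) ∧
      (∀ η > 0, ∃ r₁ r₂ : A, ‖r₁ * a * star r₁ + r₂ * c * star r₂ - b‖ < η) := by
  obtain ⟨s, hs0, hsb⟩ : ∃ w : A, 0 ≤ w ∧ w * w = b :=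
    ⟨CFC.sqrt b, CFC.sqrt_nonneg b, CFC.sqrt_mul_sqrt_self b⟩
  have hss : star s = s := hs0.isSelfAdjoint
  obtain ⟨r, hr⟩ := hab (ε / 4) (by positivity)
  set x := r * s with hx
  set z := x * star x with hz
  have hzr : r * b * star r = z := by
    rw [hz, hx, star_mul, hss, ← hsb]; noncomm_ring
  rw [hzr] at hr
  have hz0 : 0 ≤ z := mul_star_self_nonneg _
  have hzs : IsSelfAdjoint z := hz0.isSelfAdjoint
  have has : IsSelfAdjoint a := ha.isSelfAdjoint
  -- functions
  set kf : ℝ → ℝ := fun t => min (max (t - ε / 2) 0 * (2 / ε)) 1 / max t (ε / 2) with hkf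
  have hkc : Continuous kf := Continuous.div (by fun_prop) (by fun_prop) fun t =>
    (lt_max_of_lt_right (by positivity)).ne'
  have hklow : ∀ t ≤ ε / 2, kf t = 0 := fun t ht => by
    simp only [hkf]; rw [max_eq_right (a := t - ε / 2) (by linarith)]; simp
  have hkhigh : ∀ t, ε ≤ t → kf t * t = 1 := fun t ht => by
    simp only [hkf]
    rw [max_eq_left (a := t - ε / 2) (by linarith), max_eq_left (a := t) (by linarith),
      min_eq_right]
    · have : t ≠ 0 := by intro h; linarith
      field_simp
    · rw [mul_div_assoc', le_div_iff₀ hε]; linarith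
  have hk0 : kf 0 = 0 := hklow 0 (by positivity)
  set hf : ℝ → ℝ := fun t => Real.sqrt (max (t - ε) 0 / max t ε) with hhf
  have hden : ∀ t : ℝ, 0 < max t ε := fun t => lt_max_of_lt_right hε
  have hhc : Continuous hf :=
    Real.continuous_sqrt.comp (Continuous.div (by fun_prop) (by fun_prop) fun t => (hden t).ne')
  have hhlow : ∀ t ≤ ε, hf t = 0 := fun t ht => by
    simp only [hhf]; rw [max_eq_right (a := t - ε) (by linarith)]; simp
  have hh0 : hf 0 = 0 := hhlow 0 hε.le
  have hhsq : ∀ t, hf t * t * hf t = max (t - ε) 0 := fun t => by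
    rcases le_total t ε with ht | ht
    · rw [hhlow t ht, max_eq_right (by linarith)]; simp
    · have e : hf t * hf t = max (t - ε) 0 / max t ε :=
        Real.mul_self_sqrt (div_nonneg (le_max_right _ _) (hden t).le)
      rw [mul_right_comm, e, max_eq_left (a := t) ht]
      have : t ≠ 0 := by intro h; linarith
      field_simp
  set k := cfcₙ kf z with hk
  set H := cfcₙ hf z with hH
  have hks : star k = k := IsSelfAdjoint.cfcₙ
  have hHs : star H = H := IsSelfAdjoint.cfcₙ
  have hHzk : H * z * k = H := by
    rw [hH, hk]
    have e1 : cfcₙ (fun t => hf t * t) z = cfcₙ hf z * z := by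
      rw [cfcₙ_mul hf (fun t => t) z hhc.continuousOn hh0 continuousOn_id rfl, cfcₙ_id' ℝ z]
    rw [← e1, ← cfcₙ_mul (fun t => hf t * t) kf z (by fun_prop) (by simp) hkc.continuousOn hk0]
    congr 1
    ext t
    rcases le_total t ε with ht | ht
    · simp [hhlow t ht]
    · rw [mul_assoc, mul_comm t, hkhigh t ht, mul_one]
  set Z := cutDown z ε with hZ
  have hHzH : H * z * H = Z := by
    rw [hH, aux_conj z hzs hf hhc hh0, hZ, cutDown]
    congr 1; ext t; exact hhsq t
  have hZ0 : 0 ≤ Z := cfcₙ_nonneg fun t _ => le_max_right _ _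
  have hzZ : ‖z - Z‖ ≤ ε := by
    have : z - Z = cfcₙ (fun t => t - max (t - ε) 0) z := by
      rw [cfcₙ_sub (fun t => t) (fun t => max (t - ε) 0) z (by fun_prop) rfl (by fun_prop)
        (by simp [hε.le]), cfcₙ_id' ℝ z, hZ, cutDown]
    rw [this]
    refine norm_cfcₙ_le fun t ht => ?_
    have ht0 : 0 ≤ t := quasispectrum_nonneg_of_nonneg z hz0 t ht
    rw [Real.norm_eq_abs, abs_le]
    rcases le_total t ε with h | h
    · rw [max_eq_right (by linarith)]; constructor <;> linarith
    · rw [max_eq_left (by linarith)]; constructor <;> linarith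
  have haZ : ‖a - Z‖ ≤ ε / 4 + ε := by
    have : a - Z = -(z - a) + (z - Z) := by abel
    rw [this]
    refine (norm_add_le _ _).trans ?_
    rw [norm_neg]; linarith
  obtain ⟨f, hfs, hfle⟩ := aux_cut a Z has hZ0.isSelfAdjoint (ε / 4 + ε) (2 * ε) (by positivity)
    (by linarith) haZ
  have hcut0 : 0 ≤ cutDown a (2 * ε) := cfcₙ_nonneg fun t _ => le_max_right _ _
  have hfZf : 0 ≤ f * Z * f := by
    have := star_right_conjugate_nonneg hZ0 f
    rwa [hfs.star_eq] at this
  have hCut : CuntzLE (cutDown a (2 * ε)) (f * Z * f) :=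
    aux_le _ _ hcut0 hfZf 1 one_pos (by rwa [one_smul])
  set G := star x * k * x with hG
  have hGs : star G = G := by
    rw [hG]; simp only [star_mul, star_star, hks, mul_assoc]
  set Q := s - s * G with hQ
  have hQs : star Q = s - G * s := by rw [hQ, star_sub, star_mul, hss, hGs]
  refine ⟨Q * star Q, mul_star_self_nonneg _, ?_, ?_⟩
  · intro η hη
    obtain ⟨D, hD⟩ := hCut η hη
    set P := D * f * H * x with hP
    have hPP : P * star P = D * (f * Z * f) * star D := by
      rw [hP, ← hHzH, hz]
      simp only [star_mul, hHs, hfs.star_eq, mul_assoc]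
    have hPG : P * G = P := by
      have : P * G = D * f * (H * z * k) * x := by
        rw [hP, hG, hz]; simp only [mul_assoc]
      rw [this, hHzk]
    have hPQ : P * star Q = 0 := by
      rw [hQs, mul_sub, ← mul_assoc, hPG, sub_self]
    set p := D * f * H * r with hp
    have hps : p * s = P := by rw [hp, hP, hx]; simp only [mul_assoc]
    let q : A → A := fun e => e - s * star x * k * r
    let qs : A → A := fun e => e * s - s * G
    have hqs : ∀ e, q e * s = qs e := fun e => by
      simp only [q, qs, hG, hx]; simp only [sub_mul, mul_assoc]
    have hl := CStarAlgebra.increasingApproximateUnit (A := A)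
    have hne := hl.neBot
    have ht : Filter.Tendsto qs (CStarAlgebra.approximateUnit A) (nhds Q) :=
      (hl.tendsto_mul_right s).sub_const (s * G)
    have ht2 : Filter.Tendsto (fun e => ‖P * star (qs e)‖) (CStarAlgebra.approximateUnit A)
        (nhds 0) := by
      have := (tendsto_const_nhds (x := P)).mul ht.star
      simpa [hPQ] using this.norm
    have ht3 : Filter.Tendsto (fun e => ‖qs e * star P‖) (CStarAlgebra.approximateUnit A)
        (nhds 0) := by
      have h : Q * star P = 0 := by simpa using congrArg star hPQ
      have := ht.mul (tendsto_const_nhds (x := star P))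
      rw [h] at this
      simpa using this.norm
    have ht4 : Filter.Tendsto (fun e => ‖qs e * star (qs e) - Q * star Q‖)
        (CStarAlgebra.approximateUnit A) (nhds 0) := by
      have := (ht.mul ht.star).sub_const (Q * star Q)
      simpa using this.norm
    obtain ⟨e, ⟨he2, he3⟩, he4⟩ := (((ht2.eventually (gt_mem_nhds hη)).and
      (ht3.eventually (gt_mem_nhds hη))).and (ht4.eventually (gt_mem_nhds hη))).exists
    have key : ∀ u v : A, u * b * star v = (u * s) * star (v * s) := fun u v => by
      rw [star_mul, hss, ← hsb]; simp only [mul_assoc]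
    refine ⟨p, q e, ?_, ?_, ?_, ?_⟩
    · rw [key, hps, hPP]; exact hD
    · rw [key, hps, hqs]; exact he2
    · rw [key, hps, hqs]; exact he3
    · rw [key, hqs]; exact he4
  · set T := s * star x * k with hT
    have hT2 : star T = k * x * s := by
      rw [hT]; simp only [star_mul, star_star, hss, hks, mul_assoc]
    set c := Q * star Q with hc
    have hc0 : 0 ≤ c := mul_star_self_nonneg _
    have hTa : 0 ≤ T * a * star T := star_right_conjugate_nonneg ha T
    -- k z k ≤ 2 k a k
    have hkk : k * z * k ≤ (2 : ℝ) • (k * a * k) := by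
      have h1 := CStarAlgebra.star_right_conjugate_le_norm_smul (a := k) (b := z - a) (hzs.sub has)
      have h2 := h1.trans (smul_le_smul_of_nonneg_right hr.le (mul_star_self_nonneg k))
      rw [hks] at h2
      have h3 : (ε / 2) • (k * k) ≤ k * z * k := by
        rw [hk, aux_conj z hzs kf hkc hk0,
          ← cfcₙ_mul kf kf z hkc.continuousOn hk0 hkc.continuousOn hk0,
          ← cfcₙ_smul (ε / 2) _ z (by fun_prop) (by simp [hk0])]
        refine cfcₙ_mono (fun t _ => ?_) (by fun_prop) (by fun_prop) (by simp [hk0]) (by simp)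
        rw [smul_eq_mul]
        rcases le_total t (ε / 2) with h | h
        · simp [hklow t h]
        · nlinarith [mul_self_nonneg (kf t)]
      have h4 : (2 : ℝ) • (k * (z - a) * k) ≤ k * z * k := by
        refine le_trans ?_ h3
        refine (smul_le_smul_of_nonneg_left h2 (by norm_num : (0 : ℝ) ≤ 2)).trans_eq ?_
        rw [smul_smul]; congr 1; ring
      rw [← sub_nonneg] at h4 ⊢
      convert h4 using 1
      simp only [mul_sub, sub_mul, smul_sub, two_smul]
      abel
    have hsG : (s * G) * star (s * G) ≤ (2 : ℝ) • (T * a * star T) := by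
      have h1 := star_right_conjugate_le_conjugate hkk (s * star x)
      have e1 : (s * G) * star (s * G) = s * star x * (k * z * k) * star (s * star x) := by
        rw [hG, hz]; simp only [star_mul, star_star, hks, hss, mul_assoc]
      have e2 : (2 : ℝ) • (T * a * star T)
          = s * star x * ((2 : ℝ) • (k * a * k)) * star (s * star x) := by
        rw [hT2, hT]
        simp only [star_mul, star_star, hss, mul_assoc, mul_smul_comm, smul_mul_assoc]
      rw [e1, e2]; exact h1
    have hble : b ≤ (4 : ℝ) • (c + T * a * star T) := by
      have h1 : b ≤ (2 : ℝ) • (c + (s * G) * star (s * G)) := by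
        have h0 : 0 ≤ (Q - s * G) * star (Q - s * G) := mul_star_self_nonneg _
        have hbQ : b = (Q + s * G) * star (Q + s * G) := by
          rw [hQ, sub_add_cancel, hss, hsb]
        rw [← sub_nonneg]
        convert h0 using 1
        rw [hbQ, hc]
        simp only [two_smul, star_add, star_sub]
        noncomm_ring
      have h2 : (2 : ℝ) • (c + (s * G) * star (s * G))
          ≤ (2 : ℝ) • ((2 : ℝ) • c + (2 : ℝ) • (T * a * star T)) := by
        refine smul_le_smul_of_nonneg_left (add_le_add ?_ hsG) (by norm_num)
        rw [two_smul]; exact le_add_of_nonneg_left hc0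
      refine h1.trans (h2.trans_eq ?_)
      rw [← smul_add, smul_smul]; norm_num
    intro η hη
    obtain ⟨R, hR⟩ := aux_le b _ hb (add_nonneg hc0 hTa) 4 (by norm_num) hble η hη
    refine ⟨R * T, R, ?_⟩
    convert hR using 2
    rw [star_mul]; noncomm_ring

end helpers

lemma aux_norm {A B : Type*} [NonUnitalCStarAlgebra A] [NonUnitalCStarAlgebra B]
    (ι : Matrix (Fin 2) (Fin 2) A →⋆ₙₐ[ℂ] B) (M : Matrix (Fin 2) (Fin 2) A) :
    ‖ι M‖ ≤ ∑ i, ∑ j, ‖M i j‖ := by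
  have hdiag : ∀ (j : Fin 2) (x : A), ‖ι (Matrix.single j j x)‖ ≤ ‖x‖ := by
    intro j x
    let φ : A →⋆ₙₐ[ℂ] B :=
      { toFun := fun x => ι (Matrix.single j j x)
        map_smul' := fun c x => by
          rw [← Matrix.smul_single, map_smul]; rfl
        map_zero' := by simp
        map_add' := fun x y => by rw [Matrix.single_add, map_add]
        map_mul' := fun x y => by rw [← map_mul, Matrix.single_mul_single_same]
        map_star' := fun x => by
          rw [← map_star, Matrix.star_eq_conjTranspose, Matrix.conjTranspose_single] }
    exact NonUnitalStarAlgHom.norm_apply_le φ x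
  have hent : ∀ (i j : Fin 2) (x : A), ‖ι (Matrix.single i j x)‖ ≤ ‖x‖ := by
    intro i j x
    have h1 : ‖ι (Matrix.single i j x)‖ * ‖ι (Matrix.single i j x)‖ ≤ ‖x‖ * ‖x‖ := by
      rw [← CStarRing.norm_star_mul_self, ← CStarRing.norm_star_mul_self, ← map_star, ← map_mul,
        Matrix.star_eq_conjTranspose, Matrix.conjTranspose_single,
        Matrix.single_mul_single_same]
      exact hdiag j _
    exact (mul_self_le_mul_self_iff (norm_nonneg _) (norm_nonneg _)).mpr h1
  conv_lhs => rw [Matrix.matrix_eq_sum_single M]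
  rw [map_sum]
  refine (norm_sum_le _ _).trans (Finset.sum_le_sum fun i _ => ?_)
  rw [map_sum]
  exact (norm_sum_le _ _).trans (Finset.sum_le_sum fun j _ => hent i j _)

/-- **Almost algebraic order (axiom (O5)) at the level of elements.** If `a ≾ b` and `ε > 0`,
there is a positive `c` such that, in the C*-algebra `M₂(A)` of 2×2 matrices over `A` —
realized as the image of any injective star algebra homomorphism `ι` of
`Matrix (Fin 2) (Fin 2) A` into a C*-algebra `B` — one has
`diag((a - 2ε)₊, c) ≾ diag(b, 0)` and `diag(b, 0) ≾ diag(a, c)`. -/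
theorem cuntz_almost_algebraic_order {A B : Type*} [NonUnitalCStarAlgebra A]
    [NonUnitalCStarAlgebra B] [PartialOrder A] [StarOrderedRing A]
    (ι : Matrix (Fin 2) (Fin 2) A →⋆ₙₐ[ℂ] B) (hι : Function.Injective ι)
    (a b : A) (ha : 0 ≤ a) (hb : 0 ≤ b) (hab : CuntzLE a b) (ε : ℝ) (hε : 0 < ε) :
    ∃ c : A, 0 ≤ c ∧
      CuntzLE (ι (Matrix.diagonal ![cutDown a (2 * ε), c])) (ι (Matrix.diagonal ![b, 0])) ∧
      CuntzLE (ι (Matrix.diagonal ![b, 0])) (ι (Matrix.diagonal ![a, c])) := by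
  obtain ⟨c, hc, h1, h2⟩ := aux_core a b ha hb hab ε hε
  refine ⟨c, hc, ?_, ?_⟩
  · intro η hη
    obtain ⟨p, q, e1, e2, e3, e4⟩ := h1 (η / 4) (by positivity)
    refine ⟨ι !![p, 0; q, 0], ?_⟩
    rw [← map_star, ← map_mul, ← map_mul, ← map_sub]
    refine (aux_norm ι _).trans_lt ?_
    simp only [Fin.sum_univ_two, Matrix.sub_apply, Matrix.mul_apply, Matrix.star_apply,
      Matrix.diagonal_apply]
    simp
    linarith
  · intro η hη
    obtain ⟨r₁, r₂, e⟩ := h2 η hη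
    refine ⟨ι !![r₁, r₂; 0, 0], ?_⟩
    rw [← map_star, ← map_mul, ← map_mul, ← map_sub]
    refine (aux_norm ι _).trans_lt ?_
    simp only [Fin.sum_univ_two, Matrix.sub_apply, Matrix.mul_apply, Matrix.star_apply,
      Matrix.diagonal_apply]
    simpa using e
end

section
/- (Element-level almost Riesz decomposition, axiom (O6), for Cuntz comparison) Let A be a C*-algebra, let a, b, c ∈ A be positive with b * c = 0 and a ≾ b + c, and let ε > 0. Then there exist positive elements e, f ∈ A with e * f = 0 such that e ≾ (a − ε)₊, e ≾ b, f ≾ (a − ε)₊, f ≾ c, and (a − ε)₊ ≾ e + f. -/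
section helpers
variable {A : Type*} [NonUnitalCStarAlgebra A]

theorem CuntzLE.trans' {x y z : A} (h1 : CuntzLE x y) (h2 : CuntzLE y z) : CuntzLE x z := by
  intro ε hε
  obtain ⟨r, hr⟩ := h1 (ε / 2) (by positivity)
  obtain ⟨s, hs⟩ := h2 (ε / 2 / (‖r‖ * ‖r‖ + 1)) (by positivity)
  refine ⟨r * s, ?_⟩
  have e1 : r * s * z * star (r * s) - x
      = r * (s * z * star s - y) * star r + (r * y * star r - x) := by
    simp only [star_mul, mul_sub, sub_mul, mul_assoc]; abel
  rw [e1]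
  have h3 : ‖r * (s * z * star s - y) * star r‖ ≤ ε / 2 := by
    calc _ ≤ ‖r‖ * ‖s * z * star s - y‖ * ‖star r‖ :=
          (norm_mul_le _ _).trans (by gcongr; exact norm_mul_le _ _)
      _ = (‖r‖ * ‖r‖) * ‖s * z * star s - y‖ := by rw [norm_star]; ring
      _ ≤ (‖r‖ * ‖r‖ + 1) * (ε / 2 / (‖r‖ * ‖r‖ + 1)) := by gcongr; linarith
      _ = ε / 2 := by field_simp
  linarith [norm_add_le (r * (s * z * star s - y) * star r) (r * y * star r - x)]

theorem CuntzLE.conj (r y : A) : CuntzLE (r * y * star r) y := by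
  intro ε hε
  exact ⟨r, by simpa using hε⟩

variable [PartialOrder A] [StarOrderedRing A]

theorem CuntzLE.sq {y : A} (hy : 0 ≤ y) : CuntzLE y (y * y) := by
  intro ε hε
  set η := ε / 4 with hη
  have hη0 : 0 < η := by positivity
  have hne : ∀ t : ℝ, |t| + η ≠ 0 := fun t => by positivity
  have hc : Continuous (fun t : ℝ => √t / (|t| + η)) := by fun_prop (disch := exact hne _)
  have hs : IsSelfAdjoint (cfcₙ (fun t : ℝ => √t / (|t| + η)) y) := cfcₙ_predicate _ _
  refine ⟨cfcₙ (fun t : ℝ => √t / (|t| + η)) y, ?_⟩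
  rw [hs.star_eq]
  have hid : cfcₙ (fun t : ℝ => t) y = y := cfcₙ_id' ℝ y
  have key : cfcₙ (fun t : ℝ => √t / (|t| + η)) y * (y * y) * cfcₙ (fun t : ℝ => √t / (|t| + η)) y
      - y = cfcₙ (fun t : ℝ => √t / (|t| + η) * (t * t) * (√t / (|t| + η)) - t) y := by
    rw [cfcₙ_sub _ _ _ (by fun_prop (disch := exact fun _ _ => hne _)) (by simp) (by fun_prop (disch := exact fun _ _ => hne _)) (by simp),
      cfcₙ_mul _ _ _ (by fun_prop (disch := exact fun _ _ => hne _)) (by simp) (by fun_prop (disch := exact fun _ _ => hne _)) (by simp),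
      cfcₙ_mul _ _ _ (by fun_prop (disch := exact fun _ _ => hne _)) (by simp) (by fun_prop (disch := exact fun _ _ => hne _)) (by simp),
      cfcₙ_mul _ _ _ (by fun_prop (disch := exact fun _ _ => hne _)) (by simp) (by fun_prop (disch := exact fun _ _ => hne _)) (by simp), hid]
  rw [key]
  refine lt_of_le_of_lt (norm_cfcₙ_le (c := 2 * η) ?_) (by rw [hη]; linarith)
  intro t ht
  have ht0 : 0 ≤ t := quasispectrum_nonneg_of_nonneg y hy t ht
  rw [abs_of_nonneg ht0, Real.norm_eq_abs]
  have h1 : √t / (t + η) * (t * t) * (√t / (t + η)) = t * t * t / (t + η) ^ 2 := by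
    rw [show √t / (t + η) * (t * t) * (√t / (t + η)) = (√t * √t) * (t * t) / (t + η) ^ 2 by
      field_simp, Real.mul_self_sqrt ht0]; ring
  have h2 : t * t * t / (t + η) ^ 2 - t = - (t * η * (2 * t + η) / (t + η) ^ 2) := by
    have : t + η ≠ 0 := by positivity
    field_simp; ring
  rw [h1, h2, abs_neg, abs_of_nonneg (by positivity), div_le_iff₀ (by positivity)]
  have : 0 ≤ 3 * t * η * η + 2 * η * η * η := by positivity
  nlinarith

theorem CuntzLE.of_le_smul {x y : A} (hx : 0 ≤ x) (hy : 0 ≤ y) (C : ℝ)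
    (hxy : x ≤ C • y) : CuntzLE x y := by
  intro ε hε
  obtain ⟨u, hu, hux⟩ : ∃ u : A, star u = u ∧ u * u = x :=
    ⟨CFC.sqrt x, (CFC.sqrt_nonneg x).isSelfAdjoint.star_eq, CFC.sqrt_mul_sqrt_self x hx⟩
  obtain ⟨w, hw, hwx⟩ : ∃ w : A, star w = w ∧ w * w = C • y - x :=
    ⟨CFC.sqrt (C • y - x), (CFC.sqrt_nonneg _).isSelfAdjoint.star_eq,
      CFC.sqrt_mul_sqrt_self _ (sub_nonneg.2 hxy)⟩
  -- choose the size
  obtain ⟨δ, hδ0, hδ1, hδ⟩ : ∃ δ : ℝ, 0 < δ ∧ δ ≤ 1 ∧ δ * (2 * ‖u‖ + 1) < ε := by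
    refine ⟨min 1 (ε / (2 * (2 * ‖u‖ + 1))), by positivity, min_le_left _ _, ?_⟩
    calc _ ≤ (ε / (2 * (2 * ‖u‖ + 1))) * (2 * ‖u‖ + 1) := by gcongr; exact min_le_right _ _
      _ = ε / 2 := by field_simp
      _ < ε := by linarith
  set η := δ ^ 2 / (|C| + 1) with hη
  have hη0 : 0 < η := by positivity
  have hCη : |C| * η ≤ δ ^ 2 := by
    rw [hη, mul_div_assoc', div_le_iff₀ (by positivity)]; nlinarith [sq_nonneg δ]
  have hne : ∀ t : ℝ, |t| + η ≠ 0 := fun t => by positivity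
  have hc : Continuous (fun t : ℝ => √t / (|t| + η)) := by fun_prop (disch := exact hne _)
  have hc' : Continuous (fun t : ℝ => t / (|t| + η)) := by fun_prop (disch := exact hne _)
  have hid : cfcₙ (fun t : ℝ => t) y = y := cfcₙ_id' ℝ y
  obtain ⟨h, hh⟩ : ∃ h, h = cfcₙ (fun t : ℝ => √t / (|t| + η)) y := ⟨_, rfl⟩
  obtain ⟨g, hg⟩ : ∃ g, g = cfcₙ (fun t : ℝ => t / (|t| + η)) y := ⟨_, rfl⟩
  have hhs : star h = h := by
    rw [hh]; exact (cfcₙ_predicate (p := IsSelfAdjoint) _ _ : IsSelfAdjoint _).star_eq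
  have hgs : star g = g := by
    rw [hg]; exact (cfcₙ_predicate (p := IsSelfAdjoint) _ _ : IsSelfAdjoint _).star_eq
  have hgg : h * y * h = g * g := by
    conv_lhs => rw [← hid]
    rw [hh, hg, ← cfcₙ_mul _ _ _ (by fun_prop (disch := exact fun _ _ => hne _)) (by simp) (by fun_prop (disch := exact fun _ _ => hne _)) (by simp),
      ← cfcₙ_mul _ _ _ (by fun_prop (disch := exact fun _ _ => hne _)) (by simp) (by fun_prop (disch := exact fun _ _ => hne _)) (by simp),
      ← cfcₙ_mul _ _ _ (by fun_prop (disch := exact fun _ _ => hne _)) (by simp) (by fun_prop (disch := exact fun _ _ => hne _)) (by simp)]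
    refine cfcₙ_congr ?_
    intro t ht
    have ht0 : 0 ≤ t := quasispectrum_nonneg_of_nonneg y hy t ht
    have := hne t
    have h2 : √t / (|t| + η) * t * (√t / (|t| + η)) = (√t * √t) * t / (|t| + η) ^ 2 := by
      field_simp
    simp only [h2, Real.mul_self_sqrt ht0]
    field_simp
  have hyg : ‖(y - y * g) - g * (y - y * g)‖ ≤ η := by
    have : (y - y * g) - g * (y - y * g) = cfcₙ (fun t : ℝ => (t - t * (t / (|t| + η)))
        - t / (|t| + η) * (t - t * (t / (|t| + η)))) y := by
      rw [cfcₙ_sub _ _ _ (by fun_prop (disch := exact fun _ _ => hne _)) (by simp) (by fun_prop (disch := exact fun _ _ => hne _)) (by simp),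
        cfcₙ_mul _ _ _ (by fun_prop (disch := exact fun _ _ => hne _)) (by simp) (by fun_prop (disch := exact fun _ _ => hne _)) (by simp),
        cfcₙ_sub _ _ _ (by fun_prop (disch := exact fun _ _ => hne _)) (by simp) (by fun_prop (disch := exact fun _ _ => hne _)) (by simp),
        cfcₙ_mul _ _ _ (by fun_prop (disch := exact fun _ _ => hne _)) (by simp) (by fun_prop (disch := exact fun _ _ => hne _)) (by simp), hid, hg]
    rw [this]
    refine norm_cfcₙ_le ?_
    intro t ht
    have ht0 : 0 ≤ t := quasispectrum_nonneg_of_nonneg y hy t ht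
    have h0 : t + η ≠ 0 := by positivity
    rw [abs_of_nonneg ht0, Real.norm_eq_abs,
      show t - t * (t / (t + η)) - t / (t + η) * (t - t * (t / (t + η)))
        = t * η ^ 2 / (t + η) ^ 2 by field_simp; ring,
      abs_of_nonneg (by positivity), div_le_iff₀ (by positivity)]
    have : 0 ≤ η * t ^ 2 + t * η ^ 2 + η ^ 3 := by positivity
    nlinarith
  -- key estimate
  have hle : star (u - u * g) * (u - u * g) ≤ C • ((y - y * g) - g * (y - y * g)) := by
    rw [← sub_nonneg]
    have e1 : star (u - u * g) * (u - u * g) = (x - x * g) - g * (x - x * g) := by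
      rw [← hux]
      simp only [star_sub, star_mul, hu, hgs, mul_sub, sub_mul, mul_assoc]
      abel
    have e2 : star (w - w * g) * (w - w * g)
        = ((C • y - x) - (C • y - x) * g) - g * ((C • y - x) - (C • y - x) * g) := by
      rw [← hwx]
      simp only [star_sub, star_mul, hw, hgs, mul_sub, sub_mul, mul_assoc]
      abel
    have e3 : C • ((y - y * g) - g * (y - y * g)) - star (u - u * g) * (u - u * g)
        = star (w - w * g) * (w - w * g) := by
      rw [e1, e2]
      simp only [mul_sub, sub_mul, smul_sub, smul_mul_assoc, mul_smul_comm]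
      abel
    rw [e3]
    exact star_mul_self_nonneg _
  have hn : ‖u - u * g‖ ≤ δ := by
    have h1 := CStarAlgebra.norm_le_norm_of_nonneg_of_le (star_mul_self_nonneg (u - u * g)) hle
    rw [CStarRing.norm_star_mul_self, norm_smul, Real.norm_eq_abs] at h1
    have h2 : |C| * ‖(y - y * g) - g * (y - y * g)‖ ≤ |C| * η := by gcongr
    exact abs_le_of_sq_le_sq' (by nlinarith) hδ0.le |>.2
  refine ⟨u * h, ?_⟩
  have e4 : u * h * y * star (u * h) - x
      = - (u * star (u - u * g) + (u - u * g) * star (u * g)) := by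
    have : u * h * y * star (u * h) = u * (h * y * h) * u := by
      simp only [star_mul, hu, hhs, mul_assoc]
    rw [this, hgg, ← hux]
    simp only [star_sub, star_mul, hu, hgs, mul_sub, sub_mul, mul_assoc]
    abel
  rw [e4, norm_neg]
  have hug : ‖u * g‖ ≤ ‖u‖ + 1 := by
    have := norm_sub_le u (u - u * g)
    rw [sub_sub_cancel] at this
    linarith
  calc _ ≤ ‖u‖ * ‖u - u * g‖ + ‖u - u * g‖ * ‖u * g‖ := by
        refine (norm_add_le _ _).trans (add_le_add ?_ ?_)
        · exact (norm_mul_le _ _).trans (by rw [norm_star])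
        · exact (norm_mul_le _ _).trans (by rw [norm_star])
    _ ≤ ‖u‖ * δ + δ * (‖u‖ + 1) := by gcongr
    _ = δ * (2 * ‖u‖ + 1) := by ring
    _ < ε := hδ

theorem CuntzLE.star_mul_self_le (u : A) : CuntzLE (star u * u) (u * star u) := by
  refine (CuntzLE.sq (star_mul_self_nonneg u)).trans' ?_
  have := CuntzLE.conj (star u) (u * star u)
  simpa only [star_star, mul_assoc] using this

theorem CuntzLE.mul_star_self_le (u : A) : CuntzLE (u * star u) (star u * u) := by
  simpa using CuntzLE.star_mul_self_le (star u)

end helpers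

/-- **Almost Riesz decomposition (axiom (O6)) at the level of elements.** If `a ≾ b + c` with
`b ⊥ c`, then for every `ε > 0` there are orthogonal positive `e, f` with `e ≾ (a - ε)₊, b`,
`f ≾ (a - ε)₊, c` and `(a - ε)₊ ≾ e + f`. -/
theorem cuntz_almost_riesz_decomposition {A : Type*} [NonUnitalCStarAlgebra A] [PartialOrder A]
    [StarOrderedRing A] (a b c : A) (ha : 0 ≤ a) (hb : 0 ≤ b) (hc : 0 ≤ c)
    (hbc : b * c = 0) (h : CuntzLE a (b + c)) (ε : ℝ) (hε : 0 < ε) :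
    ∃ e f : A, 0 ≤ e ∧ 0 ≤ f ∧ e * f = 0 ∧
      CuntzLE e (cutDown a ε) ∧ CuntzLE e b ∧
      CuntzLE f (cutDown a ε) ∧ CuntzLE f c ∧
      CuntzLE (cutDown a ε) (e + f) := by
  obtain ⟨r, hr⟩ := h ε hε
  obtain ⟨s, hs, hsb⟩ : ∃ u : A, star u = u ∧ u * u = b :=
    ⟨CFC.sqrt b, (CFC.sqrt_nonneg b).isSelfAdjoint.star_eq, CFC.sqrt_mul_sqrt_self b hb⟩
  obtain ⟨t, ht, htc⟩ : ∃ u : A, star u = u ∧ u * u = c :=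
    ⟨CFC.sqrt c, (CFC.sqrt_nonneg c).isSelfAdjoint.star_eq, CFC.sqrt_mul_sqrt_self c hc⟩
  have hcs : star c = c := (IsSelfAdjoint.of_nonneg hc).star_eq
  have hsc : s * c = 0 := by
    rw [← CStarRing.star_mul_self_eq_zero_iff, star_mul, hs, hcs,
      show c * s * (s * c) = c * (s * s * c) by simp only [mul_assoc], hsb, hbc, mul_zero]
  have hst : s * t = 0 := by
    rw [← CStarRing.mul_star_self_eq_zero_iff, star_mul, hs, ht,
      show s * t * (t * s) = s * (t * t) * s by simp only [mul_assoc], htc, hsc, zero_mul]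
  have hts : t * s = 0 := by
    have := congrArg star hst
    simpa [hs, ht] using this
  -- the element m and its square root k
  have hm0 : 0 ≤ cutDown a ε := cfcₙ_nonneg fun t _ => le_max_right _ _
  have hid : cfcₙ (fun t : ℝ => t) a = a := cfcₙ_id' ℝ a
  obtain ⟨k, hk⟩ : ∃ k, k = cfcₙ (fun t : ℝ => √(max (t - ε) 0)) a := ⟨_, rfl⟩
  have hks : star k = k := by
    rw [hk]; exact (cfcₙ_predicate (p := IsSelfAdjoint) _ _ : IsSelfAdjoint _).star_eq
  have hkk : k * k = cutDown a ε := by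
    rw [hk, cutDown, ← cfcₙ_mul _ _ _ (by fun_prop) (by simp [hε.le]) (by fun_prop) (by simp [hε.le])]
    simp
  have hkak : k * a * k - ε • (k * k) = cutDown a ε * cutDown a ε := by
    rw [hkk]
    conv_lhs => rw [← hid]
    rw [hid, hk, cutDown]
    conv_lhs => enter [1, 1, 2]; rw [← hid]
    rw [← cfcₙ_mul _ _ _ (by fun_prop) (by simp [hε.le]) (by fun_prop) (by simp [hε.le]),
      ← cfcₙ_mul _ _ _ (by fun_prop) (by simp [hε.le]) (by fun_prop) (by simp [hε.le]),
      ← cfcₙ_mul _ _ _ (by fun_prop) (by simp [hε.le]) (by fun_prop) (by simp [hε.le]),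
      ← cfcₙ_smul _ _ _ (by fun_prop) (by simp [hε.le]),
      ← cfcₙ_sub _ _ _ (by fun_prop) (by simp [hε.le]) (by fun_prop) (by simp [hε.le])]
    refine cfcₙ_congr ?_
    intro x _
    simp only [smul_eq_mul]
    rw [mul_right_comm, Real.mul_self_sqrt (le_max_right _ _)]
    rcases le_total (x - ε) 0 with hx | hx
    · simp [max_eq_right hx]
    · rw [max_eq_left hx]; ring
  have hd0 : 0 ≤ b + c := add_nonneg hb hc
  obtain ⟨y, hy⟩ : ∃ y, y = r * (b + c) * star r := ⟨_, rfl⟩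
  have hy0 : 0 ≤ y := by rw [hy]; exact star_right_conjugate_nonneg hd0 r
  rw [← hy] at hr
  have hkyk0 : 0 ≤ k * y * k := by
    have := star_right_conjugate_nonneg hy0 k
    rwa [hks] at this
  have hmle : cutDown a ε * cutDown a ε ≤ k * y * k := by
    have h1 := CStarAlgebra.star_right_conjugate_le_norm_smul (a := k) (b := a - y)
      ((IsSelfAdjoint.of_nonneg ha).sub (IsSelfAdjoint.of_nonneg hy0))
    rw [hks] at h1
    have h2 : ‖a - y‖ • (k * k) ≤ ε • (k * k) := by
      rw [norm_sub_rev]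
      exact smul_le_smul_of_nonneg_right hr.le (hkk ▸ hm0)
    have h3 := h1.trans h2
    rw [mul_sub, sub_mul] at h3
    rw [← hkak, sub_le_comm]
    exact h3
  have hkym : CuntzLE (k * y * k) (cutDown a ε) := by
    refine CuntzLE.of_le_smul hkyk0 hm0 ‖y‖ ?_
    have h1 := CStarAlgebra.star_right_conjugate_le_norm_smul (a := k) (b := y)
      (IsSelfAdjoint.of_nonneg hy0)
    rwa [hks, hkk] at h1
  obtain ⟨u, hu⟩ : ∃ u, u = k * r * s := ⟨_, rfl⟩
  obtain ⟨v, hv⟩ : ∃ v, v = k * r * t := ⟨_, rfl⟩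
  have huv : u * star v = 0 := by
    rw [hu, hv, star_mul, ht, show k * r * s * (t * star (k * r)) = k * r * (s * t) * star (k * r)
      by simp only [mul_assoc], hst]; simp
  have hvu : v * star u = 0 := by
    have := congrArg star huv
    simpa using this
  have huu : u * star u = k * r * b * star (k * r) := by
    rw [hu, star_mul, hs, ← hsb]; simp only [mul_assoc]
  have hvv : v * star v = k * r * c * star (k * r) := by
    rw [hv, star_mul, ht, ← htc]; simp only [mul_assoc]
  have hsum : u * star u + v * star v = k * y * k := by
    rw [huu, hvv, hy]; simp only [star_mul, hks, mul_add, add_mul, mul_assoc]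
  have hu0 := mul_star_self_nonneg u
  have hv0 := mul_star_self_nonneg v
  have hum : CuntzLE (u * star u) (cutDown a ε) := by
    refine (CuntzLE.of_le_smul hu0 hkyk0 1 ?_).trans' hkym
    rw [one_smul, ← hsum]; exact le_add_of_nonneg_right hv0
  have hvm : CuntzLE (v * star v) (cutDown a ε) := by
    refine (CuntzLE.of_le_smul hv0 hkyk0 1 ?_).trans' hkym
    rw [one_smul, ← hsum]; exact le_add_of_nonneg_left hu0
  have hef0 : 0 ≤ star u * u + star v * v :=
    add_nonneg (star_mul_self_nonneg u) (star_mul_self_nonneg v)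
  refine ⟨star u * u, star v * v, star_mul_self_nonneg u, star_mul_self_nonneg v, ?_,
    (CuntzLE.star_mul_self_le u).trans' hum,
    (CuntzLE.star_mul_self_le u).trans' (huu ▸ CuntzLE.conj _ _),
    (CuntzLE.star_mul_self_le v).trans' hvm,
    (CuntzLE.star_mul_self_le v).trans' (hvv ▸ CuntzLE.conj _ _), ?_⟩
  · rw [show star u * u * (star v * v) = star u * (u * star v) * v by simp only [mul_assoc], huv]
    simp
  · have h1 : CuntzLE (cutDown a ε * cutDown a ε) (k * y * k) :=
      CuntzLE.of_le_smul ((IsSelfAdjoint.of_nonneg hm0).mul_self_nonneg) hkyk0 1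
        (by rwa [one_smul])
    have h2 : k * y * k = (u + v) * star (u + v) := by
      rw [← hsum, star_add, mul_add, add_mul, add_mul, huv, hvu]; simp
    have h3 : CuntzLE (star (u + v) * (u + v)) (star u * u + star v * v) := by
      refine CuntzLE.of_le_smul (star_mul_self_nonneg _) hef0 2 ?_
      rw [← sub_nonneg]
      have : (2 : ℝ) • (star u * u + star v * v) - star (u + v) * (u + v)
          = star (u - v) * (u - v) := by
        simp only [star_add, star_sub, mul_add, add_mul, mul_sub, sub_mul, two_smul]; abel
      rw [this]; exact star_mul_self_nonneg _
    rw [h2] at h1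
    exact (CuntzLE.sq hm0).trans' (h1.trans' ((CuntzLE.mul_star_self_le _).trans' h3))
end

section
/- (Weak cancellation of compact elements, stable rank one) Let A be a unital C*-algebra of stable rank one, i.e., the invertible elements of A are dense in A. Let p ∈ A be a projection (p = star p, p * p = p) and let a, b ∈ A be positive elements with a * p = 0 and b * p = 0. If a + p ≾ b + p, then a ≾ b. -/
theorem cz_T {A : Type*} [CStarAlgebra A] [PartialOrder A]
    [StarOrderedRing A] (v : A) (hv : 0 ≤ v) (ε : ℝ) (hε : 0 < ε) :
    ∃ h : A, star h = h ∧ ‖h * (v * v) * h - v‖ < ε := by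
  have hsa : IsSelfAdjoint v := hv.isSelfAdjoint
  set δ := ε / 2 with hδ
  have hδ0 : 0 < δ := by positivity
  have hsp : ∀ t ∈ spectrum ℝ v, 0 ≤ t := fun t ht => spectrum_nonneg_of_nonneg hv ht
  let f : ℝ → ℝ := fun t => (Real.sqrt (t + δ))⁻¹
  have hf : ContinuousOn f (spectrum ℝ v) := by
    apply ContinuousOn.inv₀
    · fun_prop
    · intro t ht
      have := hsp t ht
      exact (Real.sqrt_pos.2 (by linarith)).ne'
  have hid : ContinuousOn (fun t : ℝ => t) (spectrum ℝ v) := continuousOn_id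
  refine ⟨cfc f v, (cfc_predicate f v : IsSelfAdjoint _).star_eq, ?_⟩
  have e : cfc f v * (v * v) * cfc f v - v = cfc (fun t => f t * (t * t) * f t - t) v := by
    rw [cfc_sub (fun t => f t * (t * t) * f t) (fun t => t) v ((hf.mul (hid.mul hid)).mul hf) hid,
      cfc_mul (fun t => f t * (t * t)) f v (hf.mul (hid.mul hid)) hf,
      cfc_mul f (fun t => t * t) v hf (hid.mul hid),
      cfc_mul (fun t => t) (fun t => t) v hid hid, cfc_id' ℝ v]
  rw [e]
  refine lt_of_le_of_lt (norm_cfc_le hδ0.le ?_) (by linarith : δ < ε)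
  intro t ht
  have h0 := hsp t ht
  have h1 : f t * (t * t) * f t - t = - (δ * (t / (t + δ))) := by
    have : f t * f t = (t + δ)⁻¹ := by
      simp only [f]
      rw [← mul_inv, Real.mul_self_sqrt (by linarith)]
    have h2 : t + δ ≠ 0 := by positivity
    calc f t * (t * t) * f t - t = (f t * f t) * (t * t) - t := by ring
      _ = _ := by rw [this]; field_simp; ring
  rw [h1, norm_neg, Real.norm_of_nonneg (by positivity)]
  have : t / (t + δ) ≤ 1 := by rw [div_le_one (by positivity)]; linarith
  nlinarith

theorem cz_fact {A : Type*} [CStarAlgebra A] [PartialOrder A]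
    [StarOrderedRing A] (a b z k s : A) (ha : 0 ≤ a) (h1 : a = z * k)
    (h2 : z * star z = s * b * star s) : CuntzLE a b := by
  intro ε hε
  obtain ⟨h, hh, hn⟩ := cz_T a ha (ε / 2) (by positivity)
  have hc : 0 < ‖h * star k‖ * ‖k * h‖ + 1 := by positivity
  obtain ⟨g, hg, hgn⟩ := cz_T (star z * z) (star_mul_self_nonneg z)
    (ε / 2 / (‖h * star k‖ * ‖k * h‖ + 1)) (by positivity)
  refine ⟨h * star k * g * star z * s, ?_⟩
  have haa : a * a = star k * (star z * z) * k := by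
    have : star a = a := ha.isSelfAdjoint.star_eq
    nth_rewrite 1 [← this]
    rw [h1, star_mul]; simp only [mul_assoc]
  have e1 : h * star k * g * star z * s * b * star (h * star k * g * star z * s) - a
      = (h * star k) * (g * ((star z * z) * (star z * z)) * g - star z * z) * (k * h)
        + (h * (a * a) * h - a) := by
    rw [haa]
    have : h * star k * g * star z * s * b * star (h * star k * g * star z * s)
      = h * star k * g * star z * (s * b * star s) * z * g * k * h := by
      simp only [star_mul, star_star, hh, hg, mul_assoc]
    rw [this, ← h2]
    noncomm_ring
  rw [e1]
  refine lt_of_le_of_lt (norm_add_le _ _) ?_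
  have : ‖(h * star k) * (g * ((star z * z) * (star z * z)) * g - star z * z) * (k * h)‖
      ≤ ε / 2 := by
    refine (norm_mul_le _ _).trans ?_
    refine (mul_le_mul_of_nonneg_right (norm_mul_le _ _) (norm_nonneg _)).trans ?_
    have h3 := (lt_div_iff₀ hc).1 hgn
    have h4 := norm_nonneg (g * ((star z * z) * (star z * z)) * g - star z * z)
    nlinarith
  linarith

theorem cz_key {A : Type*} [CStarAlgebra A] [PartialOrder A]
    [StarOrderedRing A] (hA : Dense {u : A | IsUnit u}) (p e S r x : A)
    (hp : star p = p) (hp' : p * p = p) (he : p + e = 1)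
    (hS : star S = S) (hSp : S * p = 0) (hx : x = r * (S + p))
    (hd : e * (x * star x) * p = 0) (hn : ‖p * (x * star x) * p + e - 1‖ < 1) :
    CuntzLE (e * (x * star x) * e) (S * S) := by
  have hee : e = 1 - p := by rw [← he]; abel
  have hes : star e = e := by rw [hee]; simp [hp]
  have hpe : p * e = 0 := by rw [hee]; simp [mul_sub, hp']
  have hep : e * p = 0 := by rw [hee]; simp [sub_mul, hp']
  have he2 : e * e = e := by
    have : e * (p + e) = e := by rw [he, mul_one]
    rwa [mul_add, hep, zero_add] at this
  have hSe : S * e = S := by rw [hee, mul_sub, hSp, mul_one, sub_zero]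
  set t := p * x * p + e with ht
  have hts : star t = p * star x * p + e := by simp [ht, hp, hes, mul_assoc]
  obtain ⟨g, hgU, hg⟩ := hA.exists_dist_lt (star t)
    (ε := (1 - ‖p * (x * star x) * p + e - 1‖) / (‖t‖ + 1))
    (div_pos (by linarith) (by positivity))
  obtain ⟨g, rfl⟩ := hgU
  have hH : ‖1 - (t * g + p * x * e * star x * p)‖ < 1 := by
    have e1 : 1 - (t * g + p * x * e * star x * p)
      = t * (star t - g) - (p * (x * star x) * p + e - 1) := by
      have : t * star t + p * x * e * star x * p = p * (x * star x) * p + e := by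
        rw [hts, ht]
        have h1 : (p * x * p + e) * (p * star x * p + e)
          = p * x * (p * p) * star x * p + p * x * (p * e) + (e * p) * star x * p + e * e := by
          noncomm_ring
        rw [h1, hpe, hep, he2, hp']
        have h2 : p * (x * star x) * p = p * x * (p + e) * star x * p := by
          rw [he]; noncomm_ring
        rw [h2]; noncomm_ring
      rw [← this]; noncomm_ring
    rw [e1]
    refine lt_of_le_of_lt (norm_sub_le _ _) ?_
    have h1 := norm_mul_le t (star t - g)
    rw [dist_eq_norm, lt_div_iff₀ (by positivity)] at hg
    nlinarith [norm_nonneg (star t - (g : A)), norm_nonneg t]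
  have hHu : IsUnit (t * g + p * x * e * star x * p) := by
    have := (Units.oneSub _ hH).isUnit
    simpa using this
  obtain ⟨H, hHe⟩ := hHu
  set gi : A := ((g⁻¹ : Aˣ) : A) with hgi
  have hggi : (g : A) * gi = 1 := by simp [hgi]
  set W : Aˣ := H * g⁻¹ with hW
  have hWe : (W : A) = t + p * x * e * star x * p * gi := by
    rw [hW, Units.val_mul, hHe, ← hgi, add_mul, mul_assoc, hggi, mul_one]
  have heW : e * (W : A) = e := by
    rw [hWe, ht]
    have : e * (p * x * p + e + p * x * e * star x * p * gi)
      = (e * p) * x * p + e * e + (e * p) * x * e * star x * p * gi := by noncomm_ring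
    rw [this, hep, he2]; simp
  set V : A := ((W⁻¹ : Aˣ) : A) with hV
  have hWV : (W : A) * V = 1 := by simp [hV]
  have hVW : V * (W : A) = 1 := by simp [hV]
  have heV : e * V = e := by
    calc e * V = e * W * V := by rw [heW]
      _ = e := by rw [mul_assoc, hWV, mul_one]
  set y := e * star x * p * gi * p with hy
  set q := p * V * p with hq
  have hw : p * x * (p + y) = p * W * p := by
    rw [hWe, ht, hy]
    have h1 : p * (p * x * p + e + p * x * e * star x * p * gi) * p
      = (p * p) * x * (p * p) + (p * e) * p + (p * p) * x * e * star x * p * gi * p := by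
        noncomm_ring
    rw [h1, hp', hpe]; noncomm_ring
  have hqw : q * (p * x * (p + y)) = p := by
    rw [hw, hq]
    have h1 : p * V * p * (p * W * p) = p * V * (p * p) * W * p := by noncomm_ring
    have h2 : p * p * V * W * p = p := by rw [mul_assoc (p * p), hVW]; simp [hp']
    have h3 : p * V * (p + e) * W * p = p * V * p * W * p + p * V * (e * W) * p := by noncomm_ring
    rw [heW, mul_assoc (p * V) e p, hep, he, mul_one, mul_assoc p V, hVW] at h3
    rw [h1, hp']
    simpa [hp'] using h3.symm
  have hye : e * y = y := by rw [hy]; simp only [← mul_assoc, he2]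
  have hyp : y * p = y := by rw [hy, mul_assoc, hp']
  set M := e - e * x * (p + y) * q * p with hM
  have hpq : q * p = q := by rw [hq, mul_assoc, hp']
  have hMx0 : M * x * (p + y) = 0 := by
    have h1 : M * x * (p + y) = e * x * (p + y) - e * x * (p + y) * (q * (p * x * (p + y))) := by
      rw [hM]; noncomm_ring
    rw [h1, hqw]
    have h2 : e * x * (p + y) * p = e * x * (p + y) := by
      rw [mul_assoc, add_mul, hp', hyp]
    rw [h2, sub_self]
  set z := M * x * e with hz
  have hMx : M * x = z * (1 - y) := by
    have h1 : z * (1 - y) = M * x * e - M * x * (e * y) := by rw [hz]; noncomm_ring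
    have h2 : M * x = M * x * (p + e) := by rw [he, mul_one]
    have h3 : M * x * p = - (M * x * y) := by
      rw [mul_add] at hMx0; exact eq_neg_of_add_eq_zero_left hMx0
    rw [h1, hye]
    refine h2.trans ?_
    rw [mul_add, h3]; abel
  have hd' : p * (x * star x) * e = 0 := by
    have := congrArg star hd
    simpa [hp, hes, mul_assoc] using this
  have hfac : e * (x * star x) * e = z * ((1 - y) * star x * e) := by
    have h1 : z * ((1 - y) * star x * e) = (z * (1 - y)) * star x * e := by
      simp only [mul_assoc]
    rw [h1, ← hMx, hM]
    have h2 : (e - e * x * (p + y) * q * p) * x * star x * e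
      = e * (x * star x) * e - e * x * (p + y) * q * (p * (x * star x) * e) := by noncomm_ring
    rw [h2, hd', mul_zero, sub_zero]
  refine cz_fact _ _ z ((1 - y) * star x * e) (M * r) ?_ hfac ?_
  · have : e * (x * star x) * e = (e * x) * star (e * x) := by simp [hes, mul_assoc]
    rw [this]; exact mul_star_self_nonneg _
  · have : z = M * r * S := by
      rw [hz, hx]
      have h1 : M * (r * (S + p)) * e = M * r * (S * e) + M * r * (p * e) := by noncomm_ring
      rw [h1, hSe, hpe, mul_zero, add_zero]
    rw [this]; simp only [star_mul, hS, mul_assoc]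

theorem cz_main {A : Type*} [CStarAlgebra A] [PartialOrder A]
    [StarOrderedRing A] (hA : Dense {u : A | IsUnit u}) (p a b : A)
    (hp : star p = p) (hp' : p * p = p) (ha : 0 ≤ a) (hb : 0 ≤ b)
    (hap : a * p = 0) (hbp : b * p = 0) (h : CuntzLE (a + p) (b + p)) :
    CuntzLE a b := by
  have hpa : p * a = 0 := by
    have := congrArg star hap
    simpa [hp, ha.isSelfAdjoint.star_eq] using this
  obtain ⟨S, hS, hSS⟩ : ∃ S : A, star S = S ∧ S * S = b :=
    ⟨CFC.sqrt b, (CFC.sqrt_nonneg b).isSelfAdjoint.star_eq, CFC.sqrt_mul_sqrt_self b hb⟩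
  have hSp : S * p = 0 := by
    rw [← CStarRing.star_mul_self_eq_zero_iff, star_mul, hS, mul_assoc, ← mul_assoc S, hSS, hbp,
      mul_zero]
  have hpS : p * S = 0 := by
    have := congrArg star hSp
    simpa [hp, hS] using this
  obtain ⟨e, he⟩ : ∃ e : A, p + e = 1 := ⟨1 - p, by abel⟩
  have hee : e = 1 - p := by rw [← he]; abel
  have hes : star e = e := by rw [hee]; simp [hp]
  have hpe : p * e = 0 := by rw [hee]; simp [mul_sub, hp']
  have hep : e * p = 0 := by rw [hee]; simp [sub_mul, hp']
  have hea : e * a = a := by rw [hee, sub_mul, hpa, one_mul, sub_zero]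
  have hae : a * e = a := by rw [hee, mul_sub, hap, mul_one, sub_zero]
  have he2 : e * e = e := by
    have : e * (p + e) = e := by rw [he, mul_one]
    rwa [mul_add, hep, zero_add] at this
  have hpn : ‖p‖ ≤ 1 := by
    have h1 : ‖p‖ * ‖p‖ = ‖p‖ := by rw [← CStarRing.norm_star_mul_self, hp, hp']
    nlinarith [norm_nonneg p]
  have hen : ‖e‖ ≤ 1 := by
    have h1 : ‖e‖ * ‖e‖ = ‖e‖ := by rw [← CStarRing.norm_star_mul_self, hes, he2]
    nlinarith [norm_nonneg e]
  have hcut : ∀ u v w : A, ‖u‖ ≤ 1 → ‖w‖ ≤ 1 → ‖u * v * w‖ ≤ ‖v‖ := by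
    intro u v w hu hw
    refine (norm_mul_le _ _).trans ?_
    have h1 := norm_mul_le u v
    have h2 : ‖u‖ * ‖v‖ ≤ ‖v‖ := mul_le_of_le_one_left (norm_nonneg _) hu
    have h3 : ‖u * v‖ * ‖w‖ ≤ ‖u * v‖ := mul_le_of_le_one_right (norm_nonneg _) hw
    linarith
  intro ε hε
  set η := min (ε / 8) (1 / 4) with hη
  have hη0 : 0 < η := by positivity
  have hη1 : η ≤ ε / 8 := min_le_left _ _
  have hη2 : η ≤ 1 / 4 := min_le_right _ _
  obtain ⟨r, hr⟩ := h η hη0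
  set x := r * (S + p) with hx
  have hxx : x * star x = r * (b + p) * star r := by
    have : (S + p) * (S + p) = b + p := by
      rw [add_mul, mul_add, mul_add, hSp, hpS, hSS, hp']; abel
    rw [hx, star_mul, star_add, hS, hp, ← this]; simp only [mul_assoc]
  rw [← hxx] at hr
  set d := x * star x with hd
  have hds : star d = d := by simp [hd]
  clear_value d x
  set Δ := d - (a + p) with hΔ
  have hdΔ : d = a + p + Δ := by rw [hΔ]; abel
  have hpd : p * d * p = p + p * Δ * p := by
    rw [hdΔ]; simp only [mul_add, add_mul, hpa, hp', zero_mul, zero_add]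
  have hed : e * d * p = e * Δ * p := by
    rw [hdΔ]; simp only [mul_add, add_mul, hea, hep, hap, zero_mul, zero_add]
  have hpde : p * d * e = p * Δ * e := by
    rw [hdΔ]; simp only [mul_add, add_mul, hpa, hp', hpe, zero_mul, zero_add]
  have hede : e * d * e = a + e * Δ * e := by
    rw [hdΔ]; simp only [mul_add, add_mul, hea, hae, hep, zero_mul, add_zero]
  have hD1 : p * d * p + e - 1 = p * Δ * p := by
    rw [hpd, ← he]; abel
  have hDn : ‖p * Δ * p‖ < 1 / 4 := lt_of_le_of_lt (hcut _ _ _ hpn hpn) (by linarith)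
  obtain ⟨D, hD⟩ : IsUnit (p * d * p + e) := by
    have h1 : ‖1 - (p * d * p + e)‖ < 1 := by
      rw [norm_sub_rev, hD1]; linarith
    have := (Units.oneSub _ h1).isUnit
    simpa using this
  set Di : A := ((D⁻¹ : Aˣ) : A) with hDi
  have hDDi : (D : A) * Di = 1 := by simp [hDi]
  have hDiD : Di * (D : A) = 1 := by simp [hDi]
  have hDin : ‖Di‖ ≤ 2 := by
    have h1 : Di = 1 - Di * (p * Δ * p) := by
      rw [← hD1, ← hD, mul_sub, hDiD]; simp
    have h2 : ‖(1 : A)‖ ≤ 1 := by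
      have h1 : ‖(1 : A)‖ * ‖(1 : A)‖ = ‖(1 : A)‖ := by
        rw [← CStarRing.norm_star_mul_self, star_one, one_mul]
      nlinarith [norm_nonneg (1 : A)]
    have h3 : ‖Di‖ ≤ ‖(1 : A)‖ + ‖Di * (p * Δ * p)‖ := by
      calc ‖Di‖ = ‖1 - Di * (p * Δ * p)‖ := by rw [← h1]
        _ ≤ _ := norm_sub_le _ _
    have h4 := norm_mul_le Di (p * Δ * p)
    nlinarith [norm_nonneg Di]
  have hDp : (D : A) * p = p * D := by
    rw [hD, mul_add, add_mul, hpe, hep, mul_assoc (p * d), hp', ← mul_assoc, ← mul_assoc, hp']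
  have hDip : Di * p = p * Di := by
    calc Di * p = Di * (p * D) * Di := by rw [mul_assoc, mul_assoc, hDDi, mul_one]
      _ = p * Di := by rw [← hDp, ← mul_assoc, hDiD, one_mul]
  set G := 1 - e * d * p * Di with hG
  have hGe : G * e = e := by
    have : G * e = e - e * d * (p * Di) * e := by rw [hG]; noncomm_ring
    rw [this, ← hDip, ← mul_assoc, mul_assoc _ p e, hpe, mul_zero, sub_zero]
  have hpG : p * G = p := by
    have : p * G = p - (p * e) * d * p * Di := by rw [hG]; noncomm_ring
    rw [this, hpe]; simp
  have hGp : star G * p = p := by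
    have := congrArg star hpG
    simpa [hp] using this
  have hGdp : e * G * d * p = 0 := by
    have h1 : e * G * d * p = e * d * p - e * e * d * p * Di * d * p := by rw [hG]; noncomm_ring
    have h2 : e * d * (p * p) * Di * d * p = e * d * p * (Di * (p * d * p + e) * p) := by
      have : e * d * p * (Di * (p * d * p + e) * p)
        = e * d * (p * Di) * (p * d * (p * p)) + e * d * p * Di * (e * p) := by noncomm_ring
      rw [this, hep, hp', mul_zero, add_zero]
      have u1 : e * d * p * Di * d * p = e * d * (p * Di) * d * p := by noncomm_ring
      have u2 : e * d * (Di * p) * (p * d * p) = e * d * (Di * (p * p)) * d * p := by noncomm_ring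
      rw [u1, ← hDip, u2, hp']
    rw [hp'] at h2
    rw [h1, he2, h2, ← hD, hDiD, one_mul, mul_assoc (e * d), hp', sub_self]
  set x' := G * x with hx'
  have hxx' : x' * star x' = G * d * star G := by
    rw [hx', star_mul, hd]; simp only [mul_assoc]
  have k1 : e * (x' * star x') * p = 0 := by
    rw [hxx']
    have : e * (G * d * star G) * p = e * G * d * (star G * p) := by noncomm_ring
    rw [this, hGp, hGdp]
  have k2 : p * (x' * star x') * p = p * d * p := by
    rw [hxx']
    have : p * (G * d * star G) * p = (p * G) * d * (star G * p) := by noncomm_ring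
    rw [this, hGp, hpG]
  have k3 : e * (x' * star x') * e = e * d * e - e * d * p * Di * (p * d * e) := by
    rw [hxx']
    have hGs : star G = 1 - star Di * (p * d * e) := by
      rw [hG]; simp [hp, hes, hds, mul_assoc]
    have h1 : e * (G * d * star G) * e = e * G * d * e
        - e * G * d * (star Di * p) * d * (e * e) := by
      rw [hGs]; noncomm_ring
    have h2 : star Di * p = p * star Di := by
      have := congrArg star hDip
      simpa [hp] using this.symm
    have h3 : e * G * d * (star Di * p) * d * (e * e) = (e * G * d * p) * star Di * d * e := by
      rw [h2, he2]; noncomm_ring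
    rw [h1, h3, hGdp, hG]
    have h4 : e * (1 - e * d * p * Di) * d * e = e * d * e - (e * e) * d * p * Di * d * e := by
      noncomm_ring
    have h5 : e * d * p * Di * (p * d * e) = e * d * p * (Di * p) * d * e := by noncomm_ring
    rw [h4, he2, h5, hDip, ← mul_assoc (e * d * p), mul_assoc (e * d) p p, hp']
    simp
  have key := cz_key hA p e S (G * r) x' hp hp' he hS hSp
    (by rw [hx', hx, mul_assoc]) k1 (by rw [k2, hD1]; linarith)
  rw [hSS] at key
  obtain ⟨s, hs⟩ := key (ε / 2) (by positivity)
  refine ⟨s, ?_⟩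
  have hclose : ‖e * (x' * star x') * e - a‖ ≤ ε / 2 := by
    rw [k3, hede, hed, hpde]
    have h1 : a + e * Δ * e - e * Δ * p * Di * (p * Δ * e) - a
      = e * Δ * e - e * Δ * p * Di * (p * Δ * e) := by abel
    rw [h1]
    have h2 := norm_sub_le (e * Δ * e) (e * Δ * p * Di * (p * Δ * e))
    have h3 := hcut e Δ e hen hen
    have h4 := hcut e Δ p hen hpn
    have h5 := hcut p Δ e hpn hen
    have h6 : ‖e * Δ * p * Di * (p * Δ * e)‖ ≤ η * 2 * (1 / 4) := by
      refine (norm_mul_le _ _).trans ?_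
      refine mul_le_mul ((norm_mul_le _ _).trans ?_) (by linarith) (norm_nonneg _) (by positivity)
      exact mul_le_mul (by linarith) hDin (norm_nonneg _) hη0.le
    linarith
  have : s * b * star s - a = (s * b * star s - e * (x' * star x') * e)
    + (e * (x' * star x') * e - a) := by abel
  rw [this]
  exact lt_of_le_of_lt (norm_add_le _ _) (by linarith)

/-- **Weak cancellation of compact (projection) summands in stable rank one.** In a unital
C*-algebra with dense invertibles, if `p` is a projection orthogonal to the positive elements
`a` and `b`, then `a + p ≾ b + p` implies `a ≾ b`. -/
theorem cuntz_cancel_projection_of_stableRankOne {A : Type*} [CStarAlgebra A] [PartialOrder A]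
    [StarOrderedRing A] (hA : Dense {u : A | IsUnit u}) (p a b : A)
    (hp : star p = p) (hp' : p * p = p) (ha : 0 ≤ a) (hb : 0 ≤ b)
    (hap : a * p = 0) (hbp : b * p = 0) (h : CuntzLE (a + p) (b + p)) :
    CuntzLE a b := by
  exact cz_main hA p a b hp hp' ha hb hap hbp h
end
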